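/- arXiv:2111.04591 — 2 statements merged into one kernel-verified Lean document; each statement's English description precedes it below -/
import Mathlib

section
/- Let Δ ∈ (1/2, 1) be real, set Δ̄ = 1 − Δ and N_Δ = Γ(Δ̄) / ( 2^Δ √π · Γ(Δ − 1/2) ). Then for all integers n, m ∈ ℤ the double integral ∫_ℝ ∫_ℝ conj(ψ_n^{(Δ)}(x)) · ( 2^{Δ̄} N_Δ / |x − y|^{2Δ̄} ) · ψ_m^{(Δ)}(y) dx dy converges absolutely and equals Γ(Δ̄ + n)/Γ(Δ + n) if n = m, and 0 otherwise. -/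
open Complex MeasureTheory

/-- The basis wavefunction `ψ_n^{(Δ)}(x) = (2π)^{-1/2} ((1-ix)/(1+ix))^n 2^Δ (1+x²)^{-Δ}`,
with complex powers on the principal branch. -/
noncomputable def psi (Δ : ℂ) (n : ℤ) (x : ℝ) : ℂ :=
  ((Real.sqrt (2 * Real.pi) : ℂ))⁻¹ * ((1 - Complex.I * x) / (1 + Complex.I * x)) ^ n
    * (2 : ℂ) ^ Δ * ((1 : ℂ) + (x : ℂ) ^ 2) ^ (-Δ)

/-- Complementary-series normalization constant
`N_Δ = Γ(Δ̄)/(2^Δ √π Γ(Δ − 1/2))` (with `Δ̄ = 1 − Δ`). -/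
noncomputable def NDelta (Δ : ℝ) : ℝ :=
  Real.Gamma (1 - Δ) / ((2 : ℝ) ^ Δ * Real.sqrt Real.pi * Real.Gamma (Δ - 1/2))

/-- The `π`-periodic kernel `|sin u|^{2Δ-2}`. -/
noncomputable def sinKernel (Δ u : ℝ) : ℝ := |Real.sin u| ^ (2 * Δ - 2)

lemma sinKernel_nonneg (Δ u : ℝ) : 0 ≤ sinKernel Δ u :=
  Real.rpow_nonneg (abs_nonneg _) _

lemma measurable_sinKernel (Δ : ℝ) : Measurable (sinKernel Δ) := by
  unfold sinKernel
  fun_prop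

lemma periodic_sinKernel (Δ : ℝ) : Function.Periodic (sinKernel Δ) Real.pi := by
  intro u
  simp [sinKernel, Real.sin_add_pi]

lemma intervalIntegrable_sinKernel {Δ : ℝ} (hΔ : Δ ∈ Set.Ioo (1/2 : ℝ) 1) (a b : ℝ) :
    IntervalIntegrable (sinKernel Δ) volume a b := by
  refine (periodic_sinKernel Δ).intervalIntegrable Real.pi_ne_zero (t := -(Real.pi / 2)) ?_ a b
  have hr : ∀ c, IntervalIntegrable (fun u : ℝ => (2 / Real.pi) ^ (2 * Δ - 2) * |u| ^ (2 * Δ - 2))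
      volume 0 c := by
    have hpos : ∀ c, 0 ≤ c → IntervalIntegrable (fun u : ℝ => |u| ^ (2 * Δ - 2)) volume 0 c := by
      intro c hc
      refine (intervalIntegral.intervalIntegrable_rpow' (r := 2 * Δ - 2)
        (by linarith [hΔ.1])).congr ?_
      intro u hu
      rw [Set.uIoc_of_le hc] at hu
      simp [abs_of_pos hu.1]
    intro c
    refine IntervalIntegrable.const_mul ?_ _
    rcases le_total 0 c with hc | hc
    · exact hpos c hc
    · have := (IntervalIntegrable.iff_comp_neg (f := fun u : ℝ => |u| ^ (2 * Δ - 2))).1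
        (hpos (-c) (by linarith))
      simpa using this
  have hmaj := (hr (-(Real.pi / 2))).symm.trans (hr (-(Real.pi / 2) + Real.pi))
  refine hmaj.mono_fun (measurable_sinKernel Δ).aestronglyMeasurable ?_
  filter_upwards [ae_restrict_mem measurableSet_uIoc] with u hu
  rw [Set.uIoc_of_le (by linarith [Real.pi_pos])] at hu
  have hu' : |u| ≤ Real.pi / 2 := abs_le.2 ⟨hu.1.le, by linarith [hu.2]⟩
  rw [Real.norm_of_nonneg (sinKernel_nonneg Δ u), Real.norm_of_nonneg (by positivity),
    ← Real.mul_rpow (by positivity) (abs_nonneg u)]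
  rcases eq_or_ne u 0 with rfl | h0
  · simp [sinKernel]
  · exact Real.rpow_le_rpow_of_nonpos (by positivity) (Real.mul_abs_le_abs_sin hu')
      (by linarith [hΔ.2])

lemma integral_symmetric_beta {s : ℝ} (hs : 0 < s) :
    IntervalIntegrable (fun u : ℝ => (u * (1 - u)) ^ (s - 1)) volume 0 1 ∧
    ∫ u in (0 : ℝ)..1, (u * (1 - u)) ^ (s - 1)
      = Real.Gamma s * Real.Gamma s / Real.Gamma (2 * s) := by
  have hcongr : ∀ u ∈ Set.uIcc (0 : ℝ) 1,
      (u : ℂ) ^ ((s : ℂ) - 1) * (1 - (u : ℂ)) ^ ((s : ℂ) - 1)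
        = (((u * (1 - u)) ^ (s - 1) : ℝ) : ℂ) := by
    intro u hu
    rw [Set.uIcc_of_le zero_le_one] at hu
    have h1 : 0 ≤ 1 - u := by linarith [hu.2]
    rw [Real.mul_rpow hu.1 h1, ofReal_mul, ofReal_cpow hu.1, ofReal_cpow h1]
    push_cast
    rfl
  constructor
  · have h := betaIntegral_convergent (u := s) (v := s) (by simpa) (by simpa)
    refine h.norm.congr ?_
    intro u hu
    have hu' := Set.uIoc_subset_uIcc hu
    rw [Set.uIcc_of_le zero_le_one] at hu'
    simp only
    rw [hcongr u (Set.uIoc_subset_uIcc hu), norm_real, Real.norm_of_nonneg]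
    exact Real.rpow_nonneg (mul_nonneg hu'.1 (by linarith [hu'.2])) _
  · have h := betaIntegral_eq_Gamma_mul_div s s (by simpa) (by simpa)
    rw [betaIntegral, intervalIntegral.integral_congr hcongr, intervalIntegral.integral_ofReal,
      ← ofReal_add, Gamma_ofReal, Gamma_ofReal] at h
    rw [two_mul]
    exact_mod_cast h

lemma integral_sinKernel {Δ : ℝ} (hΔ : Δ ∈ Set.Ioo (1/2 : ℝ) 1) :
    ∫ u in (0 : ℝ)..Real.pi, sinKernel Δ u
      = Real.sqrt Real.pi * Real.Gamma (Δ - 1/2) / Real.Gamma Δ := by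
  have hs : 0 < Δ - 1/2 := by linarith [hΔ.1]
  obtain ⟨hint, hval⟩ := integral_symmetric_beta hs
  have hpi := Real.pi_pos
  have hsub : ∀ x ∈ Set.Icc 0 Real.pi,
      ((fun u : ℝ => (u * (1 - u)) ^ (Δ - 1/2 - 1)) ∘ fun x => (1 - Real.cos x) / 2) x
        * (Real.sin x / 2) = (2 : ℝ) ^ (2 - 2 * Δ) * sinKernel Δ x := by
    intro x hx
    have hsin : 0 ≤ Real.sin x := Real.sin_nonneg_of_mem_Icc hx
    have hq : (1 - Real.cos x) / 2 * (1 - (1 - Real.cos x) / 2) = (Real.sin x / 2) ^ (2 : ℝ) := by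
      rw [Real.rpow_two]
      nlinarith [Real.sin_sq_add_cos_sq x]
    simp only [Function.comp_apply, sinKernel]
    rw [hq, ← Real.rpow_mul (by positivity), abs_of_nonneg hsin]
    rcases hsin.eq_or_lt with h0 | h0
    · rw [← h0, Real.zero_rpow (x := 2 * Δ - 2) (by linarith [hΔ.2])]
      simp
    · rw [← Real.rpow_add_one (by positivity), Real.div_rpow hsin two_pos.le,
        show (2 : ℝ) - 2 * Δ = -(2 * Δ - 2) by ring, Real.rpow_neg two_pos.le,
        show 2 * (Δ - 1/2 - 1) + 1 = 2 * Δ - 2 by ring]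
      ring
  have himage : ∀ x ∈ Set.Ioo 0 Real.pi, (1 - Real.cos x) / 2 ∈ Set.Ioo (0 : ℝ) 1 := by
    intro x hx
    have := Real.sin_pos_of_mem_Ioo hx
    constructor <;> nlinarith [Real.sin_sq_add_cos_sq x, Real.neg_one_le_cos x, Real.cos_le_one x]
  have key := intervalIntegral.integral_comp_mul_deriv''' (a := 0) (b := Real.pi)
    (f := fun x => (1 - Real.cos x) / 2) (f' := fun x => Real.sin x / 2)
    (g := fun u => (u * (1 - u)) ^ (Δ - 1/2 - 1)) (by fun_prop)
    (fun x _ => by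
      have := (((Real.hasDerivAt_cos x).const_sub 1).div_const 2).hasDerivWithinAt (s := Set.Ioi x)
      simpa using this)
    (by
      rintro _ ⟨x, hx, rfl⟩
      rw [min_eq_left hpi.le, max_eq_right hpi.le] at hx
      have := himage x hx
      refine ContinuousAt.continuousWithinAt (ContinuousAt.rpow_const (by fun_prop) (Or.inl ?_))
      exact (mul_pos this.1 (by linarith [this.2])).ne')
    (by
      have h1 : IntegrableOn (fun u : ℝ => (u * (1 - u)) ^ (Δ - 1/2 - 1)) (Set.Icc 0 1) :=
        (intervalIntegrable_iff_integrableOn_Icc_of_le zero_le_one).1 hint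
      refine h1.mono_set ?_
      rintro _ ⟨x, -, rfl⟩
      constructor <;> linarith [Real.neg_one_le_cos x, Real.cos_le_one x])
    (by
      rw [Set.uIcc_of_le hpi.le]
      refine IntegrableOn.congr_fun ?_ (fun x hx => (hsub x hx).symm) measurableSet_Icc
      exact ((intervalIntegrable_iff_integrableOn_Icc_of_le hpi.le).1
        (intervalIntegrable_sinKernel hΔ 0 Real.pi)).const_mul _)
  rw [intervalIntegral.integral_congr (g := fun x => (2 : ℝ) ^ (2 - 2 * Δ) * sinKernel Δ x)
    (by rw [Set.uIcc_of_le hpi.le]; exact hsub), intervalIntegral.integral_const_mul] at key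
  norm_num only [Real.cos_zero, Real.cos_pi] at key
  have hdup := Real.Gamma_mul_Gamma_add_half (Δ - 1/2)
  rw [hval, show 2 - 2 * Δ = 1 - 2 * (Δ - 1/2) by ring] at key
  rw [show Δ - 1/2 + 1/2 = Δ by ring] at hdup
  have hG1 := (Real.Gamma_pos_of_pos (show 0 < 2 * (Δ - 1/2) by linarith)).ne'
  have hG2 := (Real.Gamma_pos_of_pos (show 0 < Δ by linarith)).ne'
  have hp : (2 : ℝ) ^ (1 - 2 * (Δ - 1/2)) ≠ 0 := by positivity
  rw [eq_div_iff hG1] at key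
  rw [eq_div_iff hG2]
  refine mul_left_cancel₀ (mul_ne_zero hp hG1) ?_
  linear_combination Real.Gamma Δ * key + Real.Gamma (Δ - 1/2) * hdup

lemma hasDerivAt_sin_rpow_mul_exp {Δ : ℝ} (m : ℤ) {u : ℝ} (hu : u ∈ Set.Ioo 0 Real.pi) :
    HasDerivAt (fun u : ℝ => ((Real.sin u ^ (2 * Δ - 1) : ℝ) : ℂ) * exp ((2 * m + 1) * I * u))
      ((Δ + m) * (exp (2 * (m + 1 : ℤ) * I * u) * sinKernel Δ u)
        - (1 - Δ + m) * (exp (2 * m * I * u) * sinKernel Δ u)) u := by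
  have hsin := Real.sin_pos_of_mem_Ioo hu
  have h1 := ((Real.hasDerivAt_sin u).rpow_const (p := 2 * Δ - 1) (Or.inl hsin.ne')).ofReal_comp
  have h2 : HasDerivAt (fun u : ℝ => exp ((2 * m + 1) * I * u))
      (exp ((2 * m + 1) * I * u) * ((2 * m + 1) * I * 1)) u :=
    ((ofRealCLM.hasDerivAt (x := u)).const_mul ((2 * m + 1) * I)).cexp
  refine (h1.mul h2).congr_deriv ?_
  have e1 : exp (2 * (m + 1 : ℤ) * I * u) = exp ((2 * m + 1) * I * u) * exp (u * I) := by
    rw [← Complex.exp_add]; push_cast; ring_nf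
  have e2 : exp (2 * m * I * u) = exp ((2 * m + 1) * I * u) * exp (-u * I) := by
    rw [← Complex.exp_add]; ring_nf
  have hs : Real.sin u ^ (2 * Δ - 1) = Real.sin u * Real.sin u ^ (2 * Δ - 2) := by
    rw [mul_comm (Real.sin u), ← Real.rpow_add_one hsin.ne', show 2 * Δ - 2 + 1 = 2 * Δ - 1 by ring]
  rw [e1, e2, hs, sinKernel, abs_of_pos hsin, show 2 * Δ - 1 - 1 = 2 * Δ - 2 by ring]
  push_cast
  rw [Complex.exp_mul_I, Complex.exp_mul_I, Complex.cos_neg, Complex.sin_neg]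
  ring

/-- The Fourier coefficients of `sinKernel` on a period. -/
noncomputable def sinKernelFourier (Δ : ℝ) (m : ℤ) : ℂ :=
  ∫ u in (0 : ℝ)..Real.pi, exp (2 * m * I * u) * sinKernel Δ u

lemma intervalIntegrable_exp_mul_sinKernel {Δ : ℝ} (hΔ : Δ ∈ Set.Ioo (1/2 : ℝ) 1) (m : ℤ)
    (a b : ℝ) :
    IntervalIntegrable (fun u : ℝ => exp (2 * m * I * u) * sinKernel Δ u) volume a b :=
  have h := intervalIntegrable_sinKernel hΔ a b
  IntervalIntegrable.continuousOn_mul ⟨h.1.ofReal, h.2.ofReal⟩ (by fun_prop)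

lemma sinKernelFourier_recurrence {Δ : ℝ} (hΔ : Δ ∈ Set.Ioo (1/2 : ℝ) 1) (m : ℤ) :
    (Δ + m) * sinKernelFourier Δ (m + 1) = (1 - Δ + m) * sinKernelFourier Δ m := by
  have hpos : 0 < 2 * Δ - 1 := by linarith [hΔ.1]
  have i1 := (intervalIntegrable_exp_mul_sinKernel hΔ (m + 1) 0 Real.pi).const_mul ((Δ : ℂ) + m)
  have i2 := (intervalIntegrable_exp_mul_sinKernel hΔ m 0 Real.pi).const_mul (1 - (Δ : ℂ) + m)
  have h := intervalIntegral.integral_eq_sub_of_hasDerivAt_of_le Real.pi_pos.le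
    (f := fun u : ℝ => ((Real.sin u ^ (2 * Δ - 1) : ℝ) : ℂ) * exp ((2 * m + 1) * I * u))
    (by
      refine ContinuousOn.mul (Continuous.continuousOn ?_) (by fun_prop)
      exact continuous_ofReal.comp (Real.continuous_sin.rpow_const fun _ => Or.inr hpos.le))
    (fun u hu => hasDerivAt_sin_rpow_mul_exp m hu) (i1.sub i2)
  rw [intervalIntegral.integral_sub i1 i2, intervalIntegral.integral_const_mul,
    intervalIntegral.integral_const_mul] at h
  simp only [Real.sin_pi, Real.sin_zero, Real.zero_rpow hpos.ne', ofReal_zero, zero_mul,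
    sub_zero] at h
  exact sub_eq_zero.1 h

lemma sinKernelFourier_eq {Δ : ℝ} (hΔ : Δ ∈ Set.Ioo (1/2 : ℝ) 1) (m : ℤ) :
    sinKernelFourier Δ m = ((Real.sqrt Real.pi * Real.Gamma (Δ - 1/2) / Real.Gamma (1 - Δ)
      * (Real.Gamma (1 - Δ + m) / Real.Gamma (Δ + m)) : ℝ) : ℂ) := by
  have hne : ∀ k : ℤ, Δ + k ≠ 0 := by
    intro k hk
    have h1 : ((-k : ℤ) : ℝ) < (1 : ℤ) := by push_cast; linarith [hΔ.2]
    have h2 : ((0 : ℤ) : ℝ) < (-k : ℤ) := by push_cast; linarith [hΔ.1]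
    have h3 := Int.cast_lt.1 h1
    have h4 := Int.cast_lt.1 h2
    omega
  have hne' : ∀ k : ℤ, 1 - Δ + k ≠ 0 := by
    intro k hk
    refine hne (-k - 1) ?_
    push_cast
    linarith
  have hstep : ∀ k : ℤ, (Δ + k) * (Real.Gamma (1 - Δ + (k + 1 : ℤ)) / Real.Gamma (Δ + (k + 1 : ℤ)))
      = (1 - Δ + k) * (Real.Gamma (1 - Δ + k) / Real.Gamma (Δ + k)) := by
    intro k
    push_cast
    rw [← add_assoc, ← add_assoc, Real.Gamma_add_one (hne k), Real.Gamma_add_one (hne' k)]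
    have := hne k
    field_simp
  have hstep' : ∀ (c : ℝ) (k : ℤ), ((Δ + k : ℝ) : ℂ)
        * ((c * (Real.Gamma (1 - Δ + (k + 1 : ℤ)) / Real.Gamma (Δ + (k + 1 : ℤ))) : ℝ) : ℂ)
      = ((1 - Δ + k : ℝ) : ℂ) * ((c * (Real.Gamma (1 - Δ + k) / Real.Gamma (Δ + k)) : ℝ) : ℂ) := by
    intro c k
    rw [← ofReal_mul, ← ofReal_mul]
    congr 1
    linear_combination c * hstep k
  have hrec : ∀ k : ℤ, ((Δ + k : ℝ) : ℂ) * sinKernelFourier Δ (k + 1)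
      = ((1 - Δ + k : ℝ) : ℂ) * sinKernelFourier Δ k := by
    intro k
    push_cast
    exact sinKernelFourier_recurrence hΔ k
  induction m using Int.induction_on with
  | zero =>
    have h0 : sinKernelFourier Δ 0 = ((∫ u in (0 : ℝ)..Real.pi, sinKernel Δ u : ℝ) : ℂ) := by
      simp [sinKernelFourier, intervalIntegral.integral_ofReal]
    have hG := (Real.Gamma_pos_of_pos (show 0 < 1 - Δ by linarith [hΔ.2])).ne'
    rw [h0, integral_sinKernel hΔ]
    congr 1
    simp only [Int.cast_zero, add_zero]
    field_simp
  | succ k ih =>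
    refine mul_left_cancel₀ (ofReal_ne_zero.2 (hne k)) ?_
    rw [hrec, hstep', ih]
  | pred k ih =>
    have h1 := hrec (-k - 1)
    have h2 := hstep' (Real.sqrt Real.pi * Real.Gamma (Δ - 1/2) / Real.Gamma (1 - Δ)) (-k - 1)
    rw [sub_add_cancel] at h1 h2
    refine mul_left_cancel₀ (ofReal_ne_zero.2 (hne' (-k - 1))) ?_
    rw [← h1, ← h2, ih]

/-- Lebesgue measure on the angular interval `(-π/2, π/2)`. -/
noncomputable def angleMeasure : Measure ℝ :=
  volume.restrict (Set.Ioc (-(Real.pi / 2)) (Real.pi / 2))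

instance : IsFiniteMeasure angleMeasure := by
  unfold angleMeasure; infer_instance

lemma integral_angleMeasure {E : Type*} [NormedAddCommGroup E] [NormedSpace ℝ E] (f : ℝ → E) :
    ∫ t, f t ∂angleMeasure = ∫ t in (-(Real.pi / 2))..(Real.pi / 2), f t := by
  rw [intervalIntegral.integral_of_le (by linarith [Real.pi_pos]), angleMeasure]

lemma integral_angleMeasure_sub {E : Type*} [NormedAddCommGroup E] [NormedSpace ℝ E] {f : ℝ → E}
    (hf : Function.Periodic f Real.pi) (t : ℝ) :
    ∫ s, f (t - s) ∂angleMeasure = ∫ u in (0 : ℝ)..Real.pi, f u := by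
  rw [integral_angleMeasure, intervalIntegral.integral_comp_sub_left,
    show t - -(Real.pi / 2) = (t - Real.pi / 2) + Real.pi by ring, hf.intervalIntegral_add_eq _ 0,
    zero_add]

lemma integrable_angleMeasure_sub {E : Type*} [NormedAddCommGroup E] {f : ℝ → E}
    (hf : ∀ a b, IntervalIntegrable f volume a b) (t : ℝ) :
    Integrable (fun s => f (t - s)) angleMeasure := by
  have := (hf (t + Real.pi / 2) (t - Real.pi / 2)).comp_sub_left t
  rw [sub_add_cancel_left, sub_sub_cancel] at this
  exact (intervalIntegrable_iff_integrableOn_Ioc_of_le (by linarith [Real.pi_pos])).1 this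

lemma periodic_exp_two_mul (m : ℤ) :
    Function.Periodic (fun u : ℝ => exp (2 * m * I * u)) Real.pi := by
  intro u
  simp only
  rw [show (2 * m * I * ((u + Real.pi : ℝ) : ℂ)) = 2 * m * I * u + m * (2 * Real.pi * I) by
    push_cast; ring]
  rw [Complex.exp_add, Complex.exp_int_mul_two_pi_mul_I, mul_one]

lemma integral_exp_angleMeasure (k : ℤ) :
    ∫ t : ℝ, exp (2 * k * I * t) ∂angleMeasure = if k = 0 then (Real.pi : ℂ) else 0 := by
  rw [integral_angleMeasure]
  split_ifs with hk
  · subst hk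
    simp
  · have hc : (2 * k * I : ℂ) ≠ 0 := by simp [hk]
    rw [integral_exp_mul_complex hc]
    have := periodic_exp_two_mul k (-(Real.pi / 2))
    simp only at this
    rw [show -(Real.pi / 2) + Real.pi = Real.pi / 2 by ring] at this
    rw [this, sub_self, zero_div]

/-- The integrand of the inner product in angular coordinates. -/
noncomputable def angleIntegrand (Δ : ℝ) (n m : ℤ) (p : ℝ × ℝ) : ℂ :=
  exp (2 * n * I * p.1) * sinKernel Δ (p.1 - p.2) * exp (-(2 * m * I * p.2))

lemma measurable_angleIntegrand (Δ : ℝ) (n m : ℤ) : Measurable (angleIntegrand Δ n m) := by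
  have := measurable_sinKernel Δ
  unfold angleIntegrand
  fun_prop

lemma angleIntegrand_eq (Δ : ℝ) (n m : ℤ) (t s : ℝ) :
    angleIntegrand Δ n m (t, s) = exp (2 * (n - m : ℤ) * I * t)
      * (exp (2 * m * I * (t - s : ℝ)) * sinKernel Δ (t - s)) := by
  have h : exp (2 * n * I * t) * exp (-(2 * m * I * s))
      = exp (2 * (n - m : ℤ) * I * t) * exp (2 * m * I * (t - s : ℝ)) := by
    rw [← Complex.exp_add, ← Complex.exp_add]
    push_cast
    ring_nf
  rw [angleIntegrand]
  linear_combination (sinKernel Δ (t - s) : ℂ) * h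

lemma norm_angleIntegrand (Δ : ℝ) (n m : ℤ) (t s : ℝ) :
    ‖angleIntegrand Δ n m (t, s)‖ = sinKernel Δ (t - s) := by
  have h : ∀ (k : ℤ) (u : ℝ), ‖exp (2 * k * I * u)‖ = 1 := by
    intro k u
    rw [show (2 * k * I * u : ℂ) = ((2 * k * u : ℝ) : ℂ) * I by push_cast; ring,
      norm_exp_ofReal_mul_I]
  rw [angleIntegrand_eq, norm_mul, norm_mul, h, h, norm_real,
    Real.norm_of_nonneg (sinKernel_nonneg _ _), one_mul, one_mul]

lemma integrable_angleIntegrand {Δ : ℝ} (hΔ : Δ ∈ Set.Ioo (1/2 : ℝ) 1) (n m : ℤ) :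
    Integrable (angleIntegrand Δ n m) (angleMeasure.prod angleMeasure) := by
  rw [integrable_prod_iff (measurable_angleIntegrand Δ n m).aestronglyMeasurable]
  simp only [norm_angleIntegrand, integral_angleMeasure_sub (periodic_sinKernel Δ)]
  refine ⟨Filter.Eventually.of_forall fun t => ?_, integrable_const _⟩
  simp only [angleIntegrand_eq]
  exact (integrable_angleMeasure_sub (intervalIntegrable_exp_mul_sinKernel hΔ m) t).const_mul _

lemma integral_angleIntegrand {Δ : ℝ} (hΔ : Δ ∈ Set.Ioo (1/2 : ℝ) 1) (n m : ℤ) :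
    ∫ p, angleIntegrand Δ n m p ∂(angleMeasure.prod angleMeasure)
      = if n = m then (Real.pi : ℂ) * sinKernelFourier Δ m else 0 := by
  have hper : Function.Periodic (fun u : ℝ => exp (2 * m * I * u) * sinKernel Δ u) Real.pi := by
    intro u
    have := periodic_exp_two_mul m u
    simp only at this ⊢
    rw [this, periodic_sinKernel Δ u]
  rw [integral_prod _ (integrable_angleIntegrand hΔ n m)]
  simp only [angleIntegrand_eq, integral_const_mul, integral_angleMeasure_sub hper]
  rw [integral_mul_const, integral_exp_angleMeasure, ← sinKernelFourier]
  simp only [sub_eq_zero, ite_mul, zero_mul]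

lemma map_arctan_withDensity :
    (volume.withDensity fun x : ℝ => ENNReal.ofReal (1 / (1 + x ^ 2))).map Real.arctan
      = angleMeasure := by
  have h := map_withDensity_abs_det_fderiv_eq_addHaar volume (s := Set.univ)
    MeasurableSet.univ.nullMeasurableSet
    (fun x _ => (Real.hasDerivAt_arctan x).hasFDerivAt.hasFDerivWithinAt)
    Real.arctan_injective.injOn
  rw [Measure.restrict_univ, Set.image_univ, Real.range_arctan,
    Measure.restrict_congr_set Ioo_ae_eq_Ioc] at h
  rw [angleMeasure, ← h]
  congr 2
  ext x
  rw [ContinuousLinearMap.det_toSpanSingleton, abs_of_nonneg (by positivity)]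

lemma cos_arctan_mul_one_add (x : ℝ) :
    (Real.cos (Real.arctan x) : ℂ) * (1 + I * x) = exp (I * Real.arctan x) := by
  have h := Real.tan_mul_cos (Real.cos_arctan_pos x).ne'
  rw [Real.tan_arctan] at h
  rw [mul_comm I, mul_comm I, Complex.exp_mul_I, ← ofReal_cos, ← ofReal_sin, ← h]
  push_cast
  ring

lemma cos_arctan_mul_one_sub (x : ℝ) :
    (Real.cos (Real.arctan x) : ℂ) * (1 - I * x) = exp (-(I * Real.arctan x)) := by
  have h := cos_arctan_mul_one_add (-x)
  rw [Real.arctan_neg, Real.cos_neg] at h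
  rw [ofReal_neg, ofReal_neg, mul_neg, mul_neg, ← sub_eq_add_neg] at h
  exact h

lemma cayley_zpow (n : ℤ) (x : ℝ) :
    ((1 - I * x) / (1 + I * x)) ^ n = exp (-(2 * n * I * Real.arctan x)) := by
  have hc : (Real.cos (Real.arctan x) : ℂ) ≠ 0 := ofReal_ne_zero.2 (Real.cos_arctan_pos x).ne'
  rw [← mul_div_mul_left _ _ hc, cos_arctan_mul_one_add, cos_arctan_mul_one_sub,
    ← Complex.exp_sub, ← Complex.exp_int_mul]
  ring_nf

lemma psi_ofReal (Δ : ℝ) (n : ℤ) (x : ℝ) :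
    psi Δ n x = (((Real.sqrt (2 * Real.pi))⁻¹ * 2 ^ Δ * (1 + x ^ 2) ^ (-Δ) : ℝ) : ℂ)
      * exp (-(2 * n * I * Real.arctan x)) := by
  rw [psi, cayley_zpow]
  push_cast
  rw [ofReal_cpow two_pos.le, ofReal_cpow (by positivity)]
  push_cast
  ring

lemma conj_psi_ofReal (Δ : ℝ) (n : ℤ) (x : ℝ) :
    (starRingEnd ℂ) (psi Δ n x)
      = (((Real.sqrt (2 * Real.pi))⁻¹ * 2 ^ Δ * (1 + x ^ 2) ^ (-Δ) : ℝ) : ℂ)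
        * exp (2 * n * I * Real.arctan x) := by
  rw [psi_ofReal, map_mul, conj_ofReal, ← Complex.exp_conj, map_neg, map_mul, map_mul, map_mul,
    conj_ofReal, conj_I, map_ofNat, map_intCast]
  ring_nf

lemma sinKernel_arctan_sub (Δ x y : ℝ) :
    sinKernel Δ (Real.arctan x - Real.arctan y)
      = (1 + x ^ 2) ^ (1 - Δ) * (1 + y ^ 2) ^ (1 - Δ) / |x - y| ^ (2 * (1 - Δ)) := by
  have hcos : ∀ z : ℝ, Real.cos (Real.arctan z) ^ (2 * Δ - 2) = (1 + z ^ 2) ^ (1 - Δ) := by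
    intro z
    rw [show 2 * Δ - 2 = 2 * (Δ - 1) by ring, Real.rpow_mul (Real.cos_arctan_pos z).le,
      Real.rpow_two, Real.cos_sq_arctan, one_div, Real.inv_rpow (by positivity),
      ← Real.rpow_neg (by positivity), neg_sub]
  have hx := Real.tan_mul_cos (Real.cos_arctan_pos x).ne'
  have hy := Real.tan_mul_cos (Real.cos_arctan_pos y).ne'
  rw [Real.tan_arctan] at hx hy
  have hsin : Real.sin (Real.arctan x - Real.arctan y)
      = Real.cos (Real.arctan x) * Real.cos (Real.arctan y) * (x - y) := by
    rw [Real.sin_sub, ← hx, ← hy]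
    ring
  have hcx := Real.cos_arctan_pos x
  have hcy := Real.cos_arctan_pos y
  rw [sinKernel, hsin, abs_mul, abs_of_pos (mul_pos hcx hcy),
    Real.mul_rpow (mul_pos hcx hcy).le (abs_nonneg _), Real.mul_rpow hcx.le hcy.le, hcos, hcos,
    div_eq_mul_inv, ← Real.rpow_neg (abs_nonneg _)]
  ring_nf

lemma integrand_eq_angleIntegrand (Δ : ℝ) (n m : ℤ) (x y : ℝ) :
    (starRingEnd ℂ) (psi (Δ : ℂ) n x)
        * (((2 : ℝ) ^ (1 - Δ) * NDelta Δ / |x - y| ^ (2 * (1 - Δ)) : ℝ) : ℂ)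
        * psi (Δ : ℂ) m y
      = (((2 * Real.pi)⁻¹ * 2 ^ (1 + Δ) * NDelta Δ : ℝ) : ℂ)
        * ((1 / (1 + x ^ 2) * (1 / (1 + y ^ 2)) : ℝ)
          • angleIntegrand Δ n m (Real.arctan x, Real.arctan y)) := by
  have hpow : ∀ z : ℝ, (1 + z ^ 2) ^ (-Δ) = 1 / (1 + z ^ 2) * (1 + z ^ 2) ^ (1 - Δ) := by
    intro z
    have hz : 0 < 1 + z ^ 2 := by positivity
    rw [show 1 - Δ = -Δ + 1 by ring, Real.rpow_add_one hz.ne']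
    field_simp
  have htwo : (2 : ℝ) ^ (1 + Δ) = 2 ^ Δ * 2 ^ Δ * 2 ^ (1 - Δ) := by
    rw [← Real.rpow_add two_pos, ← Real.rpow_add two_pos]
    ring_nf
  have hsqrt : (2 * Real.pi)⁻¹ = (Real.sqrt (2 * Real.pi))⁻¹ * (Real.sqrt (2 * Real.pi))⁻¹ := by
    rw [← mul_inv, Real.mul_self_sqrt (by positivity)]
  rw [conj_psi_ofReal, psi_ofReal, angleIntegrand]
  simp only [sinKernel_arctan_sub, real_smul]
  rw [hpow, hpow, htwo, hsqrt]
  push_cast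
  ring

lemma prod_angleMeasure_eq_map :
    angleMeasure.prod angleMeasure
      = ((volume : Measure (ℝ × ℝ)).withDensity fun q =>
          ENNReal.ofReal (1 / (1 + q.1 ^ 2)) * ENNReal.ofReal (1 / (1 + q.2 ^ 2))).map
        (Prod.map Real.arctan Real.arctan) := by
  rw [← map_arctan_withDensity, Measure.map_prod_map _ _ Real.measurable_arctan
    Real.measurable_arctan, prod_withDensity (by fun_prop) (by fun_prop), Measure.volume_eq_prod]

lemma integrable_prod_angleMeasure_iff {f : ℝ × ℝ → ℂ} (hf : Measurable f) :
    Integrable f (angleMeasure.prod angleMeasure) ↔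
      Integrable fun q : ℝ × ℝ => (1 / (1 + q.1 ^ 2) * (1 / (1 + q.2 ^ 2)) : ℝ)
        • f (Real.arctan q.1, Real.arctan q.2) := by
  rw [prod_angleMeasure_eq_map, integrable_map_measure hf.aestronglyMeasurable
    (Real.measurable_arctan.prodMap Real.measurable_arctan).aemeasurable,
    integrable_withDensity_iff_integrable_smul' (by fun_prop)
      (Filter.Eventually.of_forall fun q => by finiteness)]
  refine integrable_congr (Filter.Eventually.of_forall fun q => ?_)
  simp only [Function.comp_apply, Prod.map_apply', ENNReal.toReal_mul]
  rw [ENNReal.toReal_ofReal (by positivity), ENNReal.toReal_ofReal (by positivity)]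

lemma integral_prod_angleMeasure {f : ℝ × ℝ → ℂ} (hf : Measurable f) :
    ∫ p, f p ∂(angleMeasure.prod angleMeasure)
      = ∫ q : ℝ × ℝ, (1 / (1 + q.1 ^ 2) * (1 / (1 + q.2 ^ 2)) : ℝ)
        • f (Real.arctan q.1, Real.arctan q.2) := by
  rw [prod_angleMeasure_eq_map, integral_map
    (Real.measurable_arctan.prodMap Real.measurable_arctan).aemeasurable hf.aestronglyMeasurable,
    integral_withDensity_eq_integral_toReal_smul (by fun_prop)
      (Filter.Eventually.of_forall fun q => by finiteness)]
  refine integral_congr_ae (Filter.Eventually.of_forall fun q => ?_)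
  simp only [Prod.map_apply', ENNReal.toReal_mul]
  rw [ENNReal.toReal_ofReal (by positivity), ENNReal.toReal_ofReal (by positivity)]

/-- For `Δ ∈ (1/2,1)`, the basis `ψ_n^{(Δ)}` is orthogonal with respect to the
complementary-series inner product with kernel `2^{Δ̄} N_Δ |x−y|^{−2Δ̄}`, with
squared norms `Γ(Δ̄+n)/Γ(Δ+n)`. -/
theorem stmt7 (Δ : ℝ) (hΔ : Δ ∈ Set.Ioo (1/2 : ℝ) 1) (n m : ℤ) :
    Integrable (fun q : ℝ × ℝ =>
      (starRingEnd ℂ) (psi (Δ : ℂ) n q.1)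
        * (((2 : ℝ) ^ (1 - Δ) * NDelta Δ / |q.1 - q.2| ^ (2 * (1 - Δ)) : ℝ) : ℂ)
        * psi (Δ : ℂ) m q.2) ∧
    (∫ q : ℝ × ℝ,
      (starRingEnd ℂ) (psi (Δ : ℂ) n q.1)
        * (((2 : ℝ) ^ (1 - Δ) * NDelta Δ / |q.1 - q.2| ^ (2 * (1 - Δ)) : ℝ) : ℂ)
        * psi (Δ : ℂ) m q.2)
      = if n = m then ((Real.Gamma ((1 - Δ) + n) / Real.Gamma (Δ + n) : ℝ) : ℂ) else 0 := by
  simp only [integrand_eq_angleIntegrand]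
  have hmeas := measurable_angleIntegrand Δ n m
  refine ⟨((integrable_prod_angleMeasure_iff hmeas).1
    (integrable_angleIntegrand hΔ n m)).const_mul _, ?_⟩
  rw [integral_const_mul, ← integral_prod_angleMeasure hmeas, integral_angleIntegrand hΔ]
  split_ifs with hnm
  · subst hnm
    rw [sinKernelFourier_eq hΔ, ← ofReal_mul, ← ofReal_mul]
    congr 1
    have h1 := (Real.Gamma_pos_of_pos (show 0 < 1 - Δ by linarith [hΔ.2])).ne'
    have h2 := (Real.Gamma_pos_of_pos (show 0 < Δ - 1/2 by linarith [hΔ.1])).ne'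
    have h3 : Real.sqrt Real.pi ≠ 0 := (Real.sqrt_pos.2 Real.pi_pos).ne'
    have h4 : (2 : ℝ) ^ Δ ≠ 0 := by positivity
    rw [NDelta, Real.rpow_add two_pos, Real.rpow_one]
    generalize Real.Gamma (1 - Δ + n) / Real.Gamma (Δ + n) = r
    generalize Real.Gamma (1 - Δ) = a at *
    generalize Real.Gamma (Δ - 1/2) = b at *
    field_simp
  · rw [mul_zero]
end

section
/- Let N ≥ 1 be an integer, let m, n ≥ N be integers, and let ε ∈ (0,1). Then the double integral ( (−1)^N / (2π · (2N−2)!) ) · ∫_ℝ dx ∫_ℝ dt · conj(Ψ_m(x)) · (x − t − iε)^{2N−2} · Log(x − t − iε) · Ψ_n(t + iε), where Ψ_k(y) = (2π)^{−1/2} · 2^N · (1 − iy)^{k−N} · (1 + iy)^{−(k+N)} and Log is the principal branch of the complex logarithm, converges absolutely and equals (n−N)!/(N+n−1)! if m = n, and 0 otherwise. In particular its value is independent of ε ∈ (0,1). -/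
open Complex MeasureTheory

/-- Analytic continuation `Ψ_k(y) = (2π)^{−1/2} 2^N (1−iy)^{k−N} (1+iy)^{−(k+N)}`
of the discrete-series basis function `ψ_k^{(N)}` to complex arguments. -/
noncomputable def PsiD (N k : ℕ) (y : ℂ) : ℂ :=
  ((Real.sqrt (2 * Real.pi) : ℂ))⁻¹ * (2 : ℂ) ^ N
    * (1 - Complex.I * y) ^ ((k : ℤ) - N) * (1 + Complex.I * y) ^ (-((k : ℤ) + N))

open Filter Topology Asymptotics

theorem one_add_abs_isBigO_norm {c : ℂ} (hc : 0 < c.re) :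
    (fun x : ℝ => 1 + |x|) =O[⊤] fun x : ℝ => c + I * x := by
  refine IsBigO.of_bound (1 + (1 + ‖c‖) / c.re) (Eventually.of_forall fun x => ?_)
  have h1 : c.re ≤ ‖c + I * x‖ := by simpa using re_le_norm (c + I * x)
  have h2 : |x| ≤ ‖c + I * x‖ + ‖c‖ := by
    have h := norm_sub_le (c + I * x) c
    simpa using h
  have h3 : 1 + ‖c‖ ≤ (1 + ‖c‖) / c.re * ‖c + I * x‖ := by
    rw [div_mul_eq_mul_div, le_div_iff₀ hc]
    gcongr
  rw [Real.norm_of_nonneg (by positivity)]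
  linarith

theorem add_I_mul_isBigO (c : ℂ) :
    (fun x : ℝ => c + I * x) =O[⊤] fun x : ℝ => 1 + |x| := by
  refine IsBigO.of_bound (1 + ‖c‖) (Eventually.of_forall fun x => ?_)
  rw [Real.norm_of_nonneg (by positivity)]
  have h : ‖c + I * x‖ ≤ ‖c‖ + |x| := by simpa using norm_add_le c (I * x)
  nlinarith [norm_nonneg c, abs_nonneg x, mul_nonneg (norm_nonneg c) (abs_nonneg x)]

theorem log_isBigO_rpow {α : Type*} {f : α → ℂ} {g : α → ℝ} {r : ℝ} (hr : 0 < r)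
    (hf : ∀ a, r ≤ ‖f a‖) (hfg : ∀ a, ‖f a‖ ≤ g a) :
    (fun a => log (f a)) =O[⊤] fun a => g a ^ (1 / 2 : ℝ) := by
  have hg : ∀ a, r ^ (1 / 2 : ℝ) ≤ g a ^ (1 / 2 : ℝ) := fun a =>
    Real.rpow_le_rpow hr.le ((hf a).trans (hfg a)) (by norm_num)
  have hr' : 0 < r ^ (1 / 2 : ℝ) := by positivity
  refine IsBigO.of_bound (2 + (|Real.log r| + Real.pi) / r ^ (1 / 2 : ℝ))
    (Eventually.of_forall fun a => ?_)
  have hpos : 0 < ‖f a‖ := hr.trans_le (hf a)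
  have hre : |Real.log ‖f a‖| ≤ 2 * g a ^ (1 / 2 : ℝ) + |Real.log r| := by
    have h1 : Real.log ‖f a‖ ≤ ‖f a‖ ^ (1 / 2 : ℝ) / (1 / 2) :=
      Real.log_le_rpow_div hpos.le (by norm_num)
    have h2 : ‖f a‖ ^ (1 / 2 : ℝ) ≤ g a ^ (1 / 2 : ℝ) :=
      Real.rpow_le_rpow hpos.le (hfg a) (by norm_num)
    have h3 : Real.log r ≤ Real.log ‖f a‖ := Real.log_le_log hr (hf a)
    rw [abs_le]
    constructor <;> linarith [neg_abs_le (Real.log r), abs_nonneg (Real.log r), hg a]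
  have hlog : ‖log (f a)‖ ≤ |Real.log ‖f a‖| + Real.pi := by
    refine (norm_le_abs_re_add_abs_im _).trans ?_
    rw [log_re, log_im]
    gcongr
    exact abs_arg_le_pi _
  have h4 : |Real.log r| + Real.pi ≤
      (|Real.log r| + Real.pi) / r ^ (1 / 2 : ℝ) * g a ^ (1 / 2 : ℝ) := by
    rw [div_mul_eq_mul_div, le_div_iff₀ hr']
    have := Real.pi_pos
    gcongr
    exact (hf a).trans (hfg a)
  rw [Real.norm_of_nonneg (hr'.le.trans (hg a))]
  linarith

theorem log_add_I_mul_isBigO {c : ℂ} (hc : 0 < c.re) :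
    (fun x : ℝ => log (c + I * x)) =O[⊤] fun x : ℝ => (1 + |x|) ^ (1 / 2 : ℝ) := by
  have h := log_isBigO_rpow (f := fun x : ℝ => c + I * x)
    (g := fun x => (1 + ‖c‖) * (1 + |x|)) hc
    (fun x => by simpa using re_le_norm (c + I * x)) (fun x => by
      have h : ‖c + I * x‖ ≤ ‖c‖ + |x| := by simpa using norm_add_le c (I * x)
      nlinarith [norm_nonneg c, abs_nonneg x, mul_nonneg (norm_nonneg c) (abs_nonneg x)])
  refine h.trans (IsBigO.of_bound ((1 + ‖c‖) ^ (1 / 2 : ℝ)) (Eventually.of_forall fun x => ?_))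
  rw [Real.mul_rpow (by positivity) (by positivity), norm_mul,
    Real.norm_of_nonneg (r := (1 + ‖c‖) ^ (1 / 2 : ℝ)) (by positivity)]

theorem add_I_mul_pow_isBigO (c : ℂ) (d : ℕ) :
    (fun x : ℝ => (c + I * x) ^ d) =O[⊤] fun x : ℝ => (1 + |x|) ^ (d : ℝ) := by
  simpa only [Real.rpow_natCast] using (add_I_mul_isBigO c).pow d

theorem inv_add_I_mul_pow_isBigO {c : ℂ} (hc : 0 < c.re) (a : ℕ) :
    (fun x : ℝ => ((c + I * x) ^ a)⁻¹) =O[⊤] fun x : ℝ => (1 + |x|) ^ (-(a : ℝ)) := by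
  have h := ((one_add_abs_isBigO_norm hc).pow a).inv_rev (Eventually.of_forall fun x hx => by
    exact absurd hx (by positivity))
  refine h.congr_right fun x => ?_
  rw [Real.rpow_neg (by positivity), Real.rpow_natCast]

theorem inv_sub_I_mul_pow_isBigO {c : ℂ} (hc : 0 < c.re) (a : ℕ) :
    (fun x : ℝ => ((c - I * x) ^ a)⁻¹) =O[⊤] fun x : ℝ => (1 + |x|) ^ (-(a : ℝ)) := by
  have h := (inv_add_I_mul_pow_isBigO hc a).comp_tendsto (k := fun x : ℝ => -x) (l' := ⊤)
    tendsto_top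
  simpa [Function.comp_def, sub_eq_add_neg] using h

theorem rpow_one_add_abs_isBigO {s t : ℝ} (h : s ≤ t) :
    (fun x : ℝ => (1 + |x|) ^ s) =O[⊤] fun x : ℝ => (1 + |x|) ^ t := by
  refine IsBigO.of_bound 1 (Eventually.of_forall fun x => ?_)
  rw [Real.norm_of_nonneg (by positivity), Real.norm_of_nonneg (by positivity), one_mul]
  exact Real.rpow_le_rpow_of_exponent_le (by linarith [abs_nonneg x]) h

theorem integrable_of_isBigO_one_add_abs {f : ℝ → ℂ} (hf : Continuous f)
    (h : f =O[⊤] fun x : ℝ => (1 + |x|) ^ (-(3 / 2) : ℝ)) : Integrable f := by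
  refine h.integrable hf.aestronglyMeasurable ?_
  simpa using integrable_one_add_norm (E := ℝ) (μ := volume) (r := 3 / 2) (by norm_num)

theorem integral_eq_zero_of_hasDerivAt_of_isBigO {F f : ℝ → ℂ} (hF : ∀ x, HasDerivAt F (f x) x)
    (hf : Integrable f) (h : F =O[⊤] fun x : ℝ => (1 + |x|) ^ (-(1 / 2) : ℝ)) :
    ∫ x, f x = 0 := by
  have key : ∀ l : Filter ℝ, Tendsto (fun x : ℝ => |x|) l atTop → Tendsto F l (𝓝 0) := by
    intro l hl
    refine (h.mono le_top).trans_tendsto ?_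
    exact (tendsto_rpow_neg_atTop (by norm_num)).comp (tendsto_atTop_add_const_left _ 1 hl)
  simpa using integral_of_hasDerivAt_of_tendsto hF hf (key _ tendsto_abs_atBot_atTop)
    (key _ tendsto_abs_atTop_atTop)

theorem add_I_mul_mem_slitPlane {c : ℂ} (hc : 0 < c.re) (x : ℝ) : c + I * x ∈ slitPlane :=
  Or.inl (by simpa using hc)

theorem sub_I_mul_mem_slitPlane {c : ℂ} (hc : 0 < c.re) (x : ℝ) : c - I * x ∈ slitPlane :=
  Or.inl (by simpa using hc)

theorem tendsto_log_add_mul_sub_log (c : ℂ) {z : ℂ} (hz : z ∈ slitPlane) :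
    Tendsto (fun x : ℝ => log (c + z * x) - (Real.log x : ℂ)) atTop (𝓝 (log z)) := by
  have h1 : Tendsto (fun x : ℝ => c * ((x⁻¹ : ℝ) : ℂ) + z) atTop (𝓝 z) := by
    have h := (((continuous_ofReal.tendsto 0).comp tendsto_inv_atTop_zero).const_mul c).add_const z
    simpa using h
  have h2 := (continuousAt_clog hz).tendsto.comp h1
  refine h2.congr' ?_
  filter_upwards [eventually_gt_atTop 0, h1.eventually_ne (slitPlane_ne_zero hz)] with x hx hne
  have hx' : (x : ℂ) ≠ 0 := ofReal_ne_zero.2 hx.ne'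
  have h3 : c + z * x = x * (c * ((x⁻¹ : ℝ) : ℂ) + z) := by
    push_cast
    field_simp
  rw [h3, log_ofReal_mul hx hne]
  simp

theorem hasDerivAt_add_I_mul (c : ℂ) (x : ℝ) :
    HasDerivAt (fun x : ℝ => c + I * x) I x := by
  simpa using ((ofRealCLM.hasDerivAt (x := x)).const_mul I).const_add c

theorem hasDerivAt_sub_I_mul (c : ℂ) (x : ℝ) :
    HasDerivAt (fun x : ℝ => c - I * x) (-I) x := by
  simpa using ((ofRealCLM.hasDerivAt (x := x)).const_mul I).const_sub c

theorem continuous_inv_sub_I_mul_pow {c : ℂ} (hc : 0 < c.re) (a : ℕ) :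
    Continuous fun x : ℝ => ((c - I * x) ^ a)⁻¹ :=
  Continuous.inv₀ (by fun_prop) fun x =>
    pow_ne_zero a (slitPlane_ne_zero (sub_I_mul_mem_slitPlane hc x))

theorem continuous_inv_add_I_mul_pow {c : ℂ} (hc : 0 < c.re) (a : ℕ) :
    Continuous fun x : ℝ => ((c + I * x) ^ a)⁻¹ :=
  Continuous.inv₀ (by fun_prop) fun x =>
    pow_ne_zero a (slitPlane_ne_zero (add_I_mul_mem_slitPlane hc x))

theorem continuous_log_add_I_mul {c : ℂ} (hc : 0 < c.re) :
    Continuous fun x : ℝ => log (c + I * x) :=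
  Continuous.clog (by fun_prop) (add_I_mul_mem_slitPlane hc)

theorem integrable_inv_pow_mul_inv_pow {c c' : ℂ} (hc : 0 < c.re) (hc' : 0 < c'.re) {a b : ℕ}
    (hab : 2 ≤ a + b) :
    Integrable fun x : ℝ => ((c' - I * x) ^ a)⁻¹ * ((c + I * x) ^ b)⁻¹ := by
  refine integrable_of_isBigO_one_add_abs
    ((continuous_inv_sub_I_mul_pow hc' a).mul (continuous_inv_add_I_mul_pow hc b)) ?_
  refine ((inv_sub_I_mul_pow_isBigO hc' a).mul (inv_add_I_mul_pow_isBigO hc b)).trans ?_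
  refine IsBigO.trans (IsBigO.of_norm_eventuallyLE (Eventually.of_forall fun x => ?_))
    (rpow_one_add_abs_isBigO (s := -(a : ℝ) + -(b : ℝ)) ?_)
  · dsimp only
    rw [← Real.rpow_add (by positivity), Real.norm_of_nonneg (by positivity)]
  · have : (2 : ℝ) ≤ a + b := by exact_mod_cast hab
    linarith

theorem integrable_inv_pow_mul_pow {c c' : ℂ} (hc' : 0 < c'.re) {a d : ℕ}
    (had : d + 2 ≤ a) :
    Integrable fun x : ℝ => ((c' - I * x) ^ a)⁻¹ * (c + I * x) ^ d := by
  refine integrable_of_isBigO_one_add_abs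
    ((continuous_inv_sub_I_mul_pow hc' a).mul (by fun_prop)) ?_
  refine ((inv_sub_I_mul_pow_isBigO hc' a).mul (add_I_mul_pow_isBigO c d)).trans ?_
  refine IsBigO.trans (IsBigO.of_norm_eventuallyLE (Eventually.of_forall fun x => ?_))
    (rpow_one_add_abs_isBigO (s := -(a : ℝ) + d) ?_)
  · dsimp only
    rw [← Real.rpow_add (by positivity), Real.norm_of_nonneg (by positivity)]
  · have : (d + 2 : ℝ) ≤ a := by exact_mod_cast had
    linarith

theorem inv_pow_mul_pow_mul_log_isBigO {c c' : ℂ} (hc : 0 < c.re) (hc' : 0 < c'.re) (a d : ℕ) :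
    (fun x : ℝ => ((c' - I * x) ^ a)⁻¹ * (c + I * x) ^ d * log (c + I * x)) =O[⊤]
      fun x : ℝ => (1 + |x|) ^ (-(a : ℝ) + d + 1 / 2) := by
  refine (((inv_sub_I_mul_pow_isBigO hc' a).mul (add_I_mul_pow_isBigO c d)).mul
    (log_add_I_mul_isBigO hc)).congr_right fun x => ?_
  rw [← Real.rpow_add (by positivity), ← Real.rpow_add (by positivity)]

theorem integrable_inv_pow_mul_pow_mul_log {c c' : ℂ} (hc : 0 < c.re) (hc' : 0 < c'.re) {a d : ℕ}
    (had : d + 2 ≤ a) :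
    Integrable fun x : ℝ => ((c' - I * x) ^ a)⁻¹ * (c + I * x) ^ d * log (c + I * x) := by
  refine integrable_of_isBigO_one_add_abs
    (((continuous_inv_sub_I_mul_pow hc' a).mul (by fun_prop)).mul (continuous_log_add_I_mul hc)) ?_
  refine (inv_pow_mul_pow_mul_log_isBigO hc hc' a d).trans (rpow_one_add_abs_isBigO ?_)
  have : (d + 2 : ℝ) ≤ a := by exact_mod_cast had
  linarith

theorem integral_inv_sub_mul_inv_add {c c' : ℂ} (hc : 0 < c.re) (hc' : 0 < c'.re) :
    ∫ x : ℝ, (c' - I * x)⁻¹ * (c + I * x)⁻¹ = 2 * Real.pi * (c + c')⁻¹ := by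
  have hne : c + c' ≠ 0 := slitPlane_ne_zero (Or.inl (by simpa using add_pos hc hc'))
  have hint : Integrable fun x : ℝ => (c' - I * x)⁻¹ * (c + I * x)⁻¹ := by
    simpa using integrable_inv_pow_mul_inv_pow hc hc' (a := 1) (b := 1) le_rfl
  have hderiv : ∀ x : ℝ, HasDerivAt (fun x : ℝ => log (c + I * x) - log (c' - I * x))
      (I * (c + c') * ((c' - I * x)⁻¹ * (c + I * x)⁻¹)) x := fun x => by
    have h := ((hasDerivAt_add_I_mul c x).clog_real (add_I_mul_mem_slitPlane hc x)).sub
      ((hasDerivAt_sub_I_mul c' x).clog_real (sub_I_mul_mem_slitPlane hc' x))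
    refine h.congr_deriv ?_
    have h1 := slitPlane_ne_zero (add_I_mul_mem_slitPlane hc x)
    have h2 := slitPlane_ne_zero (sub_I_mul_mem_slitPlane hc' x)
    field_simp
    ring
  have hI : I ∈ slitPlane := Or.inr (by simp)
  have hI' : -I ∈ slitPlane := Or.inr (by simp)
  have htop : Tendsto (fun x : ℝ => log (c + I * x) - log (c' - I * x)) atTop
      (𝓝 (log I - log (-I))) := by
    refine ((tendsto_log_add_mul_sub_log c hI).sub
      (tendsto_log_add_mul_sub_log c' hI')).congr fun x => ?_
    simp [sub_eq_add_neg]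
  have hbot : Tendsto (fun x : ℝ => log (c + I * x) - log (c' - I * x)) atBot
      (𝓝 (log (-I) - log I)) := by
    refine (((tendsto_log_add_mul_sub_log c hI').sub
      (tendsto_log_add_mul_sub_log c' hI)).comp tendsto_neg_atBot_atTop).congr fun x => ?_
    simp [sub_eq_add_neg]
  have h := integral_of_hasDerivAt_of_tendsto hderiv (hint.const_mul _) hbot htop
  rw [integral_const_mul, log_I, log_neg_I] at h
  have h' : I * ((c + c') * ∫ x : ℝ, (c' - I * x)⁻¹ * (c + I * x)⁻¹) = I * (2 * Real.pi) := by
    linear_combination h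
  rw [eq_mul_inv_iff_mul_eq₀ hne, mul_comm]
  exact mul_left_cancel₀ I_ne_zero h'

theorem integral_inv_sub_pow {c : ℂ} (hc : 0 < c.re) (a : ℕ) :
    ∫ x : ℝ, ((c - I * x) ^ (a + 2))⁻¹ = 0 := by
  have hint : Integrable fun x : ℝ => ((c - I * x) ^ (a + 2))⁻¹ := by
    simpa using integrable_inv_pow_mul_pow (c := c) hc (a := a + 2) (d := 0) (by omega)
  have h := integral_eq_zero_of_hasDerivAt_of_isBigO
    (F := fun x : ℝ => ((c - I * x) ^ (a + 1))⁻¹)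
    (f := fun x : ℝ => (I * (a + 1)) * ((c - I * x) ^ (a + 2))⁻¹) (fun x => ?_)
    (hint.const_mul _)
    ((inv_sub_I_mul_pow_isBigO hc _).trans (rpow_one_add_abs_isBigO ?_))
  · rw [integral_const_mul] at h
    exact (mul_eq_zero.1 h).resolve_left (mul_ne_zero I_ne_zero (by exact_mod_cast a.succ_ne_zero))
  · have h0 := slitPlane_ne_zero (sub_I_mul_mem_slitPlane hc x)
    refine (((hasDerivAt_sub_I_mul c x).pow (a + 1)).inv (pow_ne_zero _ h0)).congr_deriv ?_
    simp only [Pi.pow_apply, Nat.add_sub_cancel]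
    push_cast
    field_simp
    ring
  · push_cast
    linarith [a.cast_nonneg (α := ℝ)]

theorem integral_inv_add_pow {c : ℂ} (hc : 0 < c.re) (a : ℕ) :
    ∫ x : ℝ, ((c + I * x) ^ (a + 2))⁻¹ = 0 := by
  rw [← integral_inv_sub_pow hc a, ← integral_neg_eq_self]
  simp [sub_eq_add_neg]

theorem integral_inv_sub_pow_mul_inv_add_pow {c c' : ℂ} (hc : 0 < c.re) (hc' : 0 < c'.re)
    (p b : ℕ) :
    ∫ x : ℝ, ((c' - I * x) ^ (p + 1))⁻¹ * ((c + I * x) ^ (b + 1))⁻¹ =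
      2 * Real.pi * (p + b).choose p * ((c + c') ^ (p + b + 1))⁻¹ := by
  have hne : c + c' ≠ 0 := slitPlane_ne_zero (Or.inl (by simpa using add_pos hc hc'))
  have hsplit : ∀ a b : ℕ, 1 ≤ a + b →
      ∫ x : ℝ, ((c' - I * x) ^ (a + 1))⁻¹ * ((c + I * x) ^ (b + 1))⁻¹ =
        (c + c')⁻¹ * ((∫ x : ℝ, ((c' - I * x) ^ a)⁻¹ * ((c + I * x) ^ (b + 1))⁻¹) +
          ∫ x : ℝ, ((c' - I * x) ^ (a + 1))⁻¹ * ((c + I * x) ^ b)⁻¹) := fun a b hab => by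
    rw [← integral_add (integrable_inv_pow_mul_inv_pow hc hc' (by omega))
      (integrable_inv_pow_mul_inv_pow hc hc' (by omega)), ← integral_const_mul]
    congr 1 with x
    have h1 := slitPlane_ne_zero (add_I_mul_mem_slitPlane hc x)
    have h2 := slitPlane_ne_zero (sub_I_mul_mem_slitPlane hc' x)
    field_simp
    ring
  induction p generalizing b with
  | zero =>
    induction b with
    | zero => simpa using integral_inv_sub_mul_inv_add hc hc'
    | succ b ih =>
      rw [hsplit _ _ (by omega), ih]
      simp only [pow_zero, inv_one, one_mul]
      rw [integral_inv_add_pow hc]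
      simp
      field_simp
      ring
  | succ p ihp =>
    induction b with
    | zero =>
      rw [hsplit _ _ (by omega), ihp]
      simp only [pow_zero, inv_one, mul_one]
      rw [integral_inv_sub_pow hc']
      simp
      field_simp
      ring
    | succ b ih =>
      rw [hsplit _ _ (by omega), ihp, ih]
      rw [show p + 1 + (b + 1) = (p + (b + 1)) + 1 by ring, Nat.choose_succ_succ,
        show p + 1 + b = p + (b + 1) by ring]
      push_cast
      field_simp
      ring

theorem integral_inv_sub_pow_mul_add_pow (c : ℂ) {c' : ℂ} (hc' : 0 < c'.re) {a d : ℕ}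
    (had : d + 2 ≤ a) :
    ∫ x : ℝ, ((c' - I * x) ^ a)⁻¹ * (c + I * x) ^ d = 0 := by
  induction d generalizing a with
  | zero =>
    obtain ⟨a, rfl⟩ := Nat.exists_eq_add_of_le' had
    simpa using integral_inv_sub_pow hc' a
  | succ d ih =>
    obtain ⟨a, rfl⟩ := Nat.exists_eq_add_of_le' (show 1 ≤ a by omega)
    have h : ∀ x : ℝ, ((c' - I * x) ^ (a + 1))⁻¹ * (c + I * x) ^ (d + 1) =
        (c + c') * (((c' - I * x) ^ (a + 1))⁻¹ * (c + I * x) ^ d) -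
          ((c' - I * x) ^ a)⁻¹ * (c + I * x) ^ d := fun x => by
      have h2 := slitPlane_ne_zero (sub_I_mul_mem_slitPlane hc' x)
      field_simp
      ring
    simp_rw [h]
    rw [integral_sub ((integrable_inv_pow_mul_pow hc' (by omega)).const_mul _)
      (integrable_inv_pow_mul_pow hc' (by omega)), integral_const_mul, ih (by omega),
      ih (by omega)]
    simp

theorem integral_inv_sub_pow_mul_add_pow_mul_log {c c' : ℂ} (hc : 0 < c.re) (hc' : 0 < c'.re)
    (k d : ℕ) :
    ∫ x : ℝ, ((c' - I * x) ^ (k + d + 2))⁻¹ * (c + I * x) ^ d * log (c + I * x) =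
      (-1) ^ (d + 1) * (d.factorial * k.factorial / (k + d + 1).factorial) * (2 * Real.pi) *
        ((c + c') ^ (k + 1))⁻¹ := by
  induction d with
  | zero =>
    have hbd : (fun x : ℝ => ((c' - I * x) ^ (k + 1))⁻¹ * log (c + I * x)) =O[⊤]
        fun x : ℝ => (1 + |x|) ^ (-(1 / 2) : ℝ) := by
      have h := inv_pow_mul_pow_mul_log_isBigO hc hc' (k + 1) 0
      simp only [pow_zero, mul_one] at h
      refine h.trans (rpow_one_add_abs_isBigO ?_)
      push_cast
      linarith [k.cast_nonneg (α := ℝ)]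
    have h1 : Integrable fun x : ℝ => ((c' - I * x) ^ (k + 2))⁻¹ * log (c + I * x) := by
      simpa using integrable_inv_pow_mul_pow_mul_log hc hc' (a := k + 2) (d := 0) (by omega)
    have h2 : Integrable fun x : ℝ => ((c' - I * x) ^ (k + 1))⁻¹ * (c + I * x)⁻¹ := by
      simpa using integrable_inv_pow_mul_inv_pow hc hc' (a := k + 1) (b := 1) (by omega)
    have h := integral_eq_zero_of_hasDerivAt_of_isBigO
      (f := fun x : ℝ => (I * (k + 1)) * (((c' - I * x) ^ (k + 2))⁻¹ * log (c + I * x)) +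
        I * (((c' - I * x) ^ (k + 1))⁻¹ * (c + I * x)⁻¹)) (fun x => by
          have h0 := slitPlane_ne_zero (sub_I_mul_mem_slitPlane hc' x)
          have h1 := slitPlane_ne_zero (add_I_mul_mem_slitPlane hc x)
          refine ((((hasDerivAt_sub_I_mul c' x).pow (k + 1)).inv (pow_ne_zero _ h0)).mul
            ((hasDerivAt_add_I_mul c x).clog_real (add_I_mul_mem_slitPlane hc x))).congr_deriv ?_
          simp only [Pi.pow_apply, Pi.inv_apply, Nat.add_sub_cancel]
          push_cast
          field_simp
          ring) ((h1.const_mul _).add (h2.const_mul _)) hbd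
    rw [integral_add (h1.const_mul _) (h2.const_mul _), integral_const_mul,
      integral_const_mul] at h
    have h3 := integral_inv_sub_pow_mul_inv_add_pow hc hc' k 0
    simp only [zero_add, pow_one, add_zero, Nat.choose_self, Nat.cast_one, mul_one] at h3
    rw [h3, mul_assoc, ← mul_add] at h
    have h4 := (mul_eq_zero.1 h).resolve_left I_ne_zero
    have hk : (k + 1 : ℂ) ≠ 0 := by exact_mod_cast k.succ_ne_zero
    simp only [pow_zero, mul_one, add_zero, Nat.factorial_succ, Nat.factorial_zero]
    have hkf : (k.factorial : ℂ) ≠ 0 := by exact_mod_cast k.factorial_ne_zero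
    refine mul_left_cancel₀ hk ?_
    push_cast
    rw [eq_neg_of_add_eq_zero_left h4]
    field_simp
  | succ d ih =>
    have hbd : (fun x : ℝ => ((c' - I * x) ^ (k + d + 2))⁻¹ * (c + I * x) ^ (d + 1) *
        log (c + I * x)) =O[⊤] fun x : ℝ => (1 + |x|) ^ (-(1 / 2) : ℝ) := by
      refine (inv_pow_mul_pow_mul_log_isBigO hc hc' _ _).trans (rpow_one_add_abs_isBigO ?_)
      push_cast
      linarith [k.cast_nonneg (α := ℝ)]
    have h1 := integrable_inv_pow_mul_pow_mul_log hc hc' (a := k + d + 3) (d := d + 1) (by omega)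
    have h2 := integrable_inv_pow_mul_pow_mul_log hc hc' (a := k + d + 2) (d := d) (by omega)
    have h3 := integrable_inv_pow_mul_pow (c := c) hc' (a := k + d + 2) (d := d) (by omega)
    have h := integral_eq_zero_of_hasDerivAt_of_isBigO
      (f := fun x : ℝ => (I * (k + d + 2)) *
          (((c' - I * x) ^ (k + d + 3))⁻¹ * (c + I * x) ^ (d + 1) * log (c + I * x)) +
        (I * (d + 1)) * (((c' - I * x) ^ (k + d + 2))⁻¹ * (c + I * x) ^ d * log (c + I * x)) +
        I * (((c' - I * x) ^ (k + d + 2))⁻¹ * (c + I * x) ^ d)) (fun x => by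
          have h0 := slitPlane_ne_zero (sub_I_mul_mem_slitPlane hc' x)
          have h1 := slitPlane_ne_zero (add_I_mul_mem_slitPlane hc x)
          refine (((((hasDerivAt_sub_I_mul c' x).pow (k + d + 2)).inv (pow_ne_zero _ h0)).mul
            ((hasDerivAt_add_I_mul c x).pow (d + 1))).mul
            ((hasDerivAt_add_I_mul c x).clog_real (add_I_mul_mem_slitPlane hc x))).congr_deriv ?_
          simp only [Pi.pow_apply, Pi.inv_apply, Pi.mul_apply, Nat.add_sub_cancel,
            show k + d + 2 - 1 = k + d + 1 by omega]
          push_cast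
          field_simp
          ring)
      (((h1.const_mul _).add (h2.const_mul _)).add (h3.const_mul _)) hbd
    rw [integral_add ?_ (h3.const_mul _),
      integral_add (h1.const_mul _) (h2.const_mul _), integral_const_mul,
      integral_const_mul, integral_const_mul, ih,
      integral_inv_sub_pow_mul_add_pow c hc' (by omega)] at h
    have hk : (k + d + 2 : ℂ) ≠ 0 := by exact_mod_cast (k + d + 1).succ_ne_zero
    have hkf : ((k + d + 1).factorial : ℂ) ≠ 0 := by exact_mod_cast Nat.factorial_ne_zero _
    refine mul_left_cancel₀ (mul_ne_zero I_ne_zero hk) ?_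
    rw [show k + (d + 1) + 2 = k + d + 3 by ring,
      show k + (d + 1) + 1 = (k + d + 1) + 1 by ring, Nat.factorial_succ d,
      Nat.factorial_succ (k + d + 1)]
    push_cast
    rw [mul_zero, add_zero] at h
    rw [eq_neg_of_add_eq_zero_left h]
    have hk' : (k + d + 1 + 1 : ℂ) ≠ 0 := by exact_mod_cast (k + d + 1).succ_ne_zero
    field_simp
    ring
    exact (h1.const_mul _).add (h2.const_mul _)

theorem log_neg_I_mul {w : ℂ} (hw : 0 < w.re) : log (-I * w) = log w - Real.pi / 2 * I := by
  have harg := abs_lt.1 (abs_arg_lt_pi_div_two_iff.2 (Or.inl hw))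
  rw [log_mul (neg_ne_zero.2 I_ne_zero) (slitPlane_ne_zero (Or.inl hw)), log_neg_I]
  · ring
  · rw [arg_neg_I]
    constructor <;> linarith [harg.1, harg.2, Real.pi_pos]

theorem sub_sub_I_mul_mem_slitPlane {ε : ℝ} (hε : 0 < ε) (x t : ℝ) :
    (x : ℂ) - t - I * ε ∈ slitPlane :=
  Or.inr (by simpa using hε.ne')

theorem integrable_prod_logKernel {ε : ℝ} (hε : ε ∈ Set.Ioo (0 : ℝ) 1) {c c' : ℂ}
    (hc : 0 < c.re) (hc' : 0 < c'.re) {a b d : ℕ} (ha : d + 2 ≤ a) (hb : d + 2 ≤ b) :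
    Integrable fun z : ℝ × ℝ => ((c' - I * z.1) ^ a)⁻¹ * ((z.1 : ℂ) - z.2 - I * ε) ^ d *
      log ((z.1 : ℂ) - z.2 - I * ε) * ((c + I * z.2) ^ b)⁻¹ := by
  have hle : ∀ z : ℝ × ℝ, ‖(z.1 : ℂ) - z.2 - I * ε‖ ≤ (1 + |z.1|) * (1 + |z.2|) := fun z => by
    have h1 := norm_sub_le ((z.1 : ℂ) - z.2) (I * ε)
    have h2 := norm_sub_le (z.1 : ℂ) z.2
    simp only [norm_mul, norm_I, one_mul, norm_real, Real.norm_eq_abs, abs_of_pos hε.1] at h1 h2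
    nlinarith [mul_nonneg (abs_nonneg z.1) (abs_nonneg z.2), hε.2]
  have hpow : (fun z : ℝ × ℝ => ((z.1 : ℂ) - z.2 - I * ε) ^ d) =O[⊤]
      fun z => ((1 + |z.1|) * (1 + |z.2|)) ^ d :=
    (IsBigO.of_norm_eventuallyLE (Eventually.of_forall hle)).pow d
  have hlog : (fun z : ℝ × ℝ => log ((z.1 : ℂ) - z.2 - I * ε)) =O[⊤]
      fun z => ((1 + |z.1|) * (1 + |z.2|)) ^ (1 / 2 : ℝ) :=
    log_isBigO_rpow hε.1
      (fun z => by simpa [abs_of_pos hε.1] using abs_im_le_norm ((z.1 : ℂ) - z.2 - I * ε)) hle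
  have hx := (inv_sub_I_mul_pow_isBigO hc' a).comp_tendsto
    (tendsto_top (f := (Prod.fst : ℝ × ℝ → ℝ)) (l := ⊤))
  have ht := (inv_add_I_mul_pow_isBigO hc b).comp_tendsto
    (tendsto_top (f := (Prod.snd : ℝ × ℝ → ℝ)) (l := ⊤))
  have hbase : Integrable fun x : ℝ => (1 + |x|) ^ (-(3 / 2) : ℝ) := by
    simpa using integrable_one_add_norm (E := ℝ) (μ := volume) (r := 3 / 2) (by norm_num)
  have hcont : Continuous fun z : ℝ × ℝ => ((c' - I * z.1) ^ a)⁻¹ *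
      ((z.1 : ℂ) - z.2 - I * ε) ^ d * log ((z.1 : ℂ) - z.2 - I * ε) * ((c + I * z.2) ^ b)⁻¹ :=
    ((((continuous_inv_sub_I_mul_pow hc' a).comp continuous_fst).mul (by fun_prop)).mul
      (Continuous.clog (by fun_prop) fun z => sub_sub_I_mul_mem_slitPlane hε.1 z.1 z.2)).mul
      ((continuous_inv_add_I_mul_pow hc b).comp continuous_snd)
  refine IsBigO.integrable hcont.aestronglyMeasurable ?_ (hbase.mul_prod hbase)
  refine (((hx.mul hpow).mul hlog).mul ht).trans
    (IsBigO.of_norm_eventuallyLE (Eventually.of_forall fun z => ?_))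
  have hdecay : ∀ (s : ℝ) (e : ℕ), d + 2 ≤ e → (1 + |s|) ^ (-(e : ℝ)) * (1 + |s|) ^ d *
      (1 + |s|) ^ (1 / 2 : ℝ) ≤ (1 + |s|) ^ (-(3 / 2) : ℝ) := fun s e he => by
    have he' : (d + 2 : ℝ) ≤ e := by exact_mod_cast he
    rw [← Real.rpow_natCast, ← Real.rpow_add (by positivity), ← Real.rpow_add (by positivity)]
    exact Real.rpow_le_rpow_of_exponent_le (by linarith [abs_nonneg s]) (by linarith)
  simp only [Function.comp_apply]
  rw [Real.norm_of_nonneg (by positivity), Real.mul_rpow (by positivity) (by positivity), mul_pow]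
  refine le_of_eq_of_le ?_ (mul_le_mul (hdecay z.1 a ha) (hdecay z.2 b hb) (by positivity)
    (by positivity))
  ring

theorem integral_inv_sub_pow_mul_logKernel {ε : ℝ} (hε : 0 < ε) {c' : ℂ} (hc' : 0 < c'.re)
    (t : ℝ) (k d : ℕ) :
    ∫ x : ℝ, ((c' - I * x) ^ (k + d + 2))⁻¹ * ((x : ℂ) - t - I * ε) ^ d *
        log ((x : ℂ) - t - I * ε) =
      (-I) ^ d * ((-1) ^ (d + 1) * (d.factorial * k.factorial / (k + d + 1).factorial) *
        (2 * Real.pi) * ((c' + ε - I * t) ^ (k + 1))⁻¹) := by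
  have hc : 0 < ((ε : ℂ) - I * t).re := by simpa using hε
  have hker : ∀ x : ℝ, ((c' - I * x) ^ (k + d + 2))⁻¹ * ((x : ℂ) - t - I * ε) ^ d *
        log ((x : ℂ) - t - I * ε) =
      (-I) ^ d * (((c' - I * x) ^ (k + d + 2))⁻¹ * (((ε : ℂ) - I * t) + I * x) ^ d *
          log (((ε : ℂ) - I * t) + I * x)) -
        (-I) ^ d * (Real.pi / 2 * I) *
          (((c' - I * x) ^ (k + d + 2))⁻¹ * (((ε : ℂ) - I * t) + I * x) ^ d) := fun x => by
    have hz : (x : ℂ) - t - I * ε = -I * (((ε : ℂ) - I * t) + I * x) := by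
      linear_combination (x - t : ℂ) * I_sq
    rw [hz, log_neg_I_mul (by simpa using hε), mul_pow]
    ring
  simp_rw [hker]
  rw [integral_sub ((integrable_inv_pow_mul_pow_mul_log hc hc' (by omega)).const_mul _)
    ((integrable_inv_pow_mul_pow hc' (by omega)).const_mul _), integral_const_mul,
    integral_const_mul, integral_inv_sub_pow_mul_add_pow _ hc' (by omega),
    integral_inv_sub_pow_mul_add_pow_mul_log hc hc', mul_zero, sub_zero]
  congr 5
  ring

theorem integral_prod_logKernel {ε : ℝ} (hε : ε ∈ Set.Ioo (0 : ℝ) 1) (p q d : ℕ) :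
    ∫ z : ℝ × ℝ, ((1 - I * z.1) ^ (p + d + 2))⁻¹ * ((z.1 : ℂ) - z.2 - I * ε) ^ d *
        log ((z.1 : ℂ) - z.2 - I * ε) * (((1 - ε : ℂ) + I * z.2) ^ (q + d + 2))⁻¹ =
      (-I) ^ d * (-1) ^ (d + 1) * (2 * Real.pi) ^ 2 * d.factorial *
        ((p + q + d + 1).factorial / ((p + d + 1).factorial * (q + d + 1).factorial)) *
        (2 ^ (p + q + d + 2))⁻¹ := by
  have hc : 0 < (1 - ε : ℂ).re := by simpa using hε.2
  have hc' : 0 < (1 + ε : ℂ).re := by simpa using by linarith [hε.1]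
  have hint := integrable_prod_logKernel hε hc (c' := 1) (by simp) (a := p + d + 2)
    (b := q + d + 2) (d := d) (by omega) (by omega)
  rw [Measure.volume_eq_prod] at hint ⊢
  rw [integral_prod_symm _ hint]
  simp_rw [integral_mul_const,
    integral_inv_sub_pow_mul_logKernel hε.1 (c' := 1) (by simp) _ p d, mul_assoc,
    integral_const_mul]
  have h := integral_inv_sub_pow_mul_inv_add_pow hc hc' p (q + d + 1)
  rw [show q + d + 1 + 1 = q + d + 2 by ring, show (1 - ε + (1 + ε) : ℂ) = 2 by ring,
    show p + (q + d + 1) = p + q + d + 1 by ring] at h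
  rw [h]
  have hch : ((p + q + d + 1).choose p : ℂ) =
      (p + q + d + 1).factorial / (p.factorial * (q + d + 1).factorial) := by
    rw [Nat.cast_choose ℂ (by omega), show p + q + d + 1 - p = q + d + 1 by omega]
  rw [hch, show p + q + d + 1 + 1 = p + q + d + 2 by ring]
  have h1 : (p.factorial : ℂ) ≠ 0 := by exact_mod_cast p.factorial_ne_zero
  field_simp

open Polynomial in
theorem sum_neg_one_pow_choose_mul_factorial_div {p L : ℕ} (hp : p ≤ L) (r : ℕ) :
    ∑ q ∈ Finset.range (L + 1), (-1 : ℂ) ^ (L - q) * L.choose q *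
      ((p + q + r).factorial / (q + r).factorial) = if p = L then (L.factorial : ℂ) else 0 := by
  set P : ℂ[X] := (ascPochhammer ℂ p).comp (X + C ((r : ℂ) + 1)) with hP
  have hmonic : P.Monic := (monic_ascPochhammer ℂ p).comp_X_add_C _
  have hdeg : P.natDegree = p := by
    rw [hP, natDegree_comp, ascPochhammer_natDegree, natDegree_X_add_C, mul_one]
  have heval : ∀ q : ℕ, P.eval (q : ℂ) = (p + q + r).factorial / (q + r).factorial := fun q => by
    have h := Nat.factorial_mul_ascFactorial (q + r) p
    rw [eq_div_iff (by exact_mod_cast Nat.factorial_ne_zero _), hP, eval_comp]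
    simp only [eval_add, eval_X, eval_C]
    rw [show (q : ℂ) + (r + 1) = ((q + r + 1 : ℕ) : ℂ) by push_cast; ring,
      ← ascPochhammer_eval_cast, ascPochhammer_nat_eq_ascFactorial, mul_comm]
    rw [show p + q + r = q + r + p by ring]
    exact_mod_cast h
  have hsum := fwdDiff_iter_eq_sum_shift (1 : ℂ) P.eval L 0
  simp only [nsmul_eq_mul, mul_one, zero_add, heval, zsmul_eq_mul] at hsum
  push_cast at hsum
  rw [← hsum]
  split_ifs with h
  · subst h
    have h := P.fwdDiff_iter_degree_eq_factorial
    rw [hdeg] at h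
    rw [h, hmonic.leadingCoeff]
    simp
  · rw [fwdDiff_iter_eq_zero_of_degree_lt (by omega)]
    rfl

theorem sum_sum_choose_mul_choose_mul_factorial_div (M L r : ℕ) :
    ∑ p ∈ Finset.range (M + 1), ∑ q ∈ Finset.range (L + 1),
      ((-1 : ℂ) ^ (M - p) * M.choose p) * ((-1 : ℂ) ^ (L - q) * L.choose q) *
        ((p + q + r).factorial / ((p + r).factorial * (q + r).factorial)) =
      if M = L then (L.factorial : ℂ) / (L + r).factorial else 0 := by
  wlog hML : M ≤ L generalizing M L
  · rw [Finset.sum_comm]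
    have h := this L M (by omega)
    rw [if_neg (by omega)] at h ⊢
    rw [← h]
    refine Finset.sum_congr rfl fun p _ => Finset.sum_congr rfl fun q _ => ?_
    rw [add_comm q p]
    ring
  have hinner : ∀ p ∈ Finset.range (M + 1), ∑ q ∈ Finset.range (L + 1),
      ((-1 : ℂ) ^ (M - p) * M.choose p) * ((-1 : ℂ) ^ (L - q) * L.choose q) *
        ((p + q + r).factorial / ((p + r).factorial * (q + r).factorial)) =
      if p = L then (-1 : ℂ) ^ (M - p) * M.choose p / (p + r).factorial * L.factorial else 0 := by
    intro p hp
    rw [← mul_ite_zero, ← sum_neg_one_pow_choose_mul_factorial_div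
      (by have := Finset.mem_range.1 hp; omega) r, Finset.mul_sum]
    refine Finset.sum_congr rfl fun q _ => ?_
    field_simp
  rw [Finset.sum_congr rfl hinner, Finset.sum_ite_eq']
  rcases hML.lt_or_eq with h | rfl
  · rw [if_neg (by simp; omega), if_neg h.ne]
  · simp
    ring

theorem two_sub_pow_mul_inv_pow {u : ℂ} (hu : u ≠ 0) (M r : ℕ) :
    (2 - u) ^ M * (u ^ (M + r))⁻¹ =
      ∑ p ∈ Finset.range (M + 1), 2 ^ p * ((-1) ^ (M - p) * M.choose p) * (u ^ (p + r))⁻¹ := by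
  rw [sub_eq_add_neg, add_pow, Finset.sum_mul]
  refine Finset.sum_congr rfl fun p hp => ?_
  obtain ⟨k, rfl⟩ := Nat.exists_eq_add_of_le (Nat.lt_succ_iff.1 (Finset.mem_range.1 hp))
  rw [Nat.add_sub_cancel_left, neg_pow u]
  field_simp
  ring

theorem PsiD_add_eq_sum (N M : ℕ) {y : ℂ} (hy : 1 + I * y ≠ 0) :
    PsiD N (N + M) y = (Real.sqrt (2 * Real.pi) : ℂ)⁻¹ * 2 ^ N *
      ∑ p ∈ Finset.range (M + 1),
        2 ^ p * ((-1) ^ (M - p) * M.choose p) * ((1 + I * y) ^ (p + 2 * N))⁻¹ := by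
  rw [← two_sub_pow_mul_inv_pow hy, PsiD,
    show ((N + M : ℕ) : ℤ) - N = (M : ℕ) by push_cast; ring,
    show -(((N + M : ℕ) : ℤ) + N) = -((M + 2 * N : ℕ) : ℤ) by push_cast; ring,
    zpow_neg, zpow_natCast, zpow_natCast]
  ring

theorem conj_PsiD_add_eq_sum (N M : ℕ) (x : ℝ) :
    (starRingEnd ℂ) (PsiD N (N + M) x) = (Real.sqrt (2 * Real.pi) : ℂ)⁻¹ * 2 ^ N *
      ∑ p ∈ Finset.range (M + 1),
        2 ^ p * ((-1) ^ (M - p) * M.choose p) * ((1 - I * x) ^ (p + 2 * N))⁻¹ := by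
  rw [PsiD_add_eq_sum N M (slitPlane_ne_zero (add_I_mul_mem_slitPlane (by simp) x))]
  simp [sub_eq_add_neg, show (starRingEnd ℂ) 2 = 2 from map_ofNat _ 2]

theorem conj_PsiD_mul_logKernel_mul_PsiD_eq_sum {ε : ℝ} (hε : ε < 1) (N M L d : ℕ) (x t : ℝ) :
    (starRingEnd ℂ) (PsiD N (N + M) x) * ((x : ℂ) - t - I * ε) ^ d * log ((x : ℂ) - t - I * ε) *
        PsiD N (N + L) (t + I * ε) =
      ∑ p ∈ Finset.range (M + 1), ∑ q ∈ Finset.range (L + 1),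
        ((2 * Real.pi : ℂ)⁻¹ * 2 ^ (p + q + 2 * N) *
          (((-1) ^ (M - p) * M.choose p) * ((-1) ^ (L - q) * L.choose q))) *
        (((1 - I * x) ^ (p + 2 * N))⁻¹ * ((x : ℂ) - t - I * ε) ^ d *
          log ((x : ℂ) - t - I * ε) * (((1 - ε : ℂ) + I * t) ^ (q + 2 * N))⁻¹) := by
  have hy : 1 + I * (t + I * ε) = (1 - ε : ℂ) + I * t := by
    linear_combination (ε : ℂ) * I_sq
  have hsqrt : ((Real.sqrt (2 * Real.pi) : ℂ)⁻¹) ^ 2 = (2 * Real.pi : ℂ)⁻¹ := by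
    rw [inv_pow, ← ofReal_pow, Real.sq_sqrt (by positivity)]
    push_cast
    rfl
  rw [conj_PsiD_add_eq_sum, PsiD_add_eq_sum, hy, ← hsqrt]
  · simp only [Finset.mul_sum, Finset.sum_mul]
    rw [Finset.sum_comm]
    refine Finset.sum_congr rfl fun p _ => Finset.sum_congr rfl fun q _ => ?_
    ring
  · rw [hy]
    exact slitPlane_ne_zero (add_I_mul_mem_slitPlane (by simpa using hε) t)

/-- The contour-shifted logarithmic-kernel inner product on the discrete series
`D_N^+`: `(ψ_m^{(N)}, ψ_n^{(N)}) = δ_{mn} (n−N)!/(N+n−1)!`, independently of the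
contour shift `ε ∈ (0,1)`. -/
theorem stmt11 (N m n : ℕ) (hN : 1 ≤ N) (hm : N ≤ m) (hn : N ≤ n)
    (ε : ℝ) (hε : ε ∈ Set.Ioo (0 : ℝ) 1) :
    Integrable (fun q : ℝ × ℝ =>
      (starRingEnd ℂ) (PsiD N m (q.1 : ℂ))
        * ((q.1 : ℂ) - q.2 - Complex.I * ε) ^ (2 * N - 2)
        * Complex.log ((q.1 : ℂ) - q.2 - Complex.I * ε)
        * PsiD N n ((q.2 : ℂ) + Complex.I * ε)) ∧
    ((-1 : ℂ) ^ N / (2 * (Real.pi : ℂ) * (Nat.factorial (2 * N - 2) : ℂ)))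
      * (∫ q : ℝ × ℝ,
          (starRingEnd ℂ) (PsiD N m (q.1 : ℂ))
            * ((q.1 : ℂ) - q.2 - Complex.I * ε) ^ (2 * N - 2)
            * Complex.log ((q.1 : ℂ) - q.2 - Complex.I * ε)
            * PsiD N n ((q.2 : ℂ) + Complex.I * ε))
      = if m = n then ((Nat.factorial (n - N) : ℂ) / (Nat.factorial (N + n - 1) : ℂ))
        else 0 := by
  obtain ⟨M, rfl⟩ := Nat.exists_eq_add_of_le hm
  obtain ⟨L, rfl⟩ := Nat.exists_eq_add_of_le hn
  obtain ⟨e, rfl⟩ := Nat.exists_eq_add_of_le' hN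
  have hint : ∀ p q : ℕ, Integrable fun z : ℝ × ℝ =>
      ((1 - I * z.1) ^ (p + 2 * (e + 1)))⁻¹ * ((z.1 : ℂ) - z.2 - I * ε) ^ (2 * (e + 1) - 2) *
        log ((z.1 : ℂ) - z.2 - I * ε) * (((1 - ε : ℂ) + I * z.2) ^ (q + 2 * (e + 1)))⁻¹ :=
    fun p q => integrable_prod_logKernel hε (by simpa using hε.2) (by simp) (by omega) (by omega)
  simp_rw [conj_PsiD_mul_logKernel_mul_PsiD_eq_sum hε.2]
  refine ⟨integrable_finsetSum _ fun p _ => integrable_finsetSum _ fun q _ =>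
    (hint p q).const_mul _, ?_⟩
  rw [integral_finsetSum _ fun p _ => integrable_finsetSum _ fun q _ =>
    (hint p q).const_mul _]
  simp_rw [integral_finsetSum _ fun q _ => (hint _ q).const_mul _, integral_const_mul]
  simp only [add_right_inj, Nat.add_sub_cancel_left]
  rw [show e + 1 + (e + 1 + L) - 1 = L + (2 * e + 1) by omega,
    ← sum_sum_choose_mul_choose_mul_factorial_div M L (2 * e + 1), Finset.mul_sum]
  refine Finset.sum_congr rfl fun p _ => ?_
  rw [Finset.mul_sum]
  refine Finset.sum_congr rfl fun q _ => ?_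
  have h := integral_prod_logKernel hε p q (2 * e)
  rw [show 2 * (e + 1) - 2 = 2 * e by omega]
  simp only [show ∀ k, k + 2 * (e + 1) = k + 2 * e + 2 by intro k; ring]
  rw [h]
  have hI : (-I) ^ (2 * e) = (-1) ^ e := by rw [pow_mul, neg_sq, I_sq]
  have hsign : (-1 : ℂ) ^ (2 * e + 1) = -1 := by rw [pow_succ, pow_mul]; simp
  have hsq : (-1 : ℂ) ^ (e + 1) * (-1) ^ e = -1 := by rw [← pow_add, ← hsign]; congr 1; ring
  have hpi : (Real.pi : ℂ) ≠ 0 := by exact_mod_cast Real.pi_ne_zero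
  have hf : ((2 * e).factorial : ℂ) ≠ 0 := by exact_mod_cast Nat.factorial_ne_zero _
  rw [hI, hsign]
  simp only [← add_assoc]
  field_simp
  linear_combination (-(M.choose p : ℂ) * L.choose q * (p + q + 2 * e + 1).factorial /
    ((p + 2 * e + 1).factorial * (q + 2 * e + 1).factorial)) * hsq
end
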